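/- arXiv:2411.03573 — 3 statements merged into one kernel-verified Lean document; each statement's English description precedes it below -/
import Mathlib

section
/- Let (R, R⁺) be an analytic perfectoid pair of characteristic p with ideal of definition generated by x_0, ..., x_m ∈ R⁺. Then in the ring W^b(R) of Witt vectors with bounded Teichmüller coordinates, the Teichmüller lifts [x_0], ..., [x_m] generate the unit ideal; consequently W^b(R) is an analytic Huber ring with ring of definition W(R⁺) and ideal of definition ([x_0], ..., [x_m]). -/
open Filter

/-- `w` has bounded Teichmüller coordinates: `w = ∑ pⁿ [x̄ₙ]` with
`x̄ₙ = (w.coeff n)^{1/pⁿ}` of norm at most `C`. -/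
def BddTeich (p : ℕ) [Fact p.Prime] {R : Type*} [CommRing R] (nm : R → ℝ)
    (w : WittVector p R) : Prop :=
  ∃ C : ℝ, ∀ n : ℕ, ∃ y : R, y ^ p ^ n = w.coeff n ∧ nm y ≤ C

namespace S15
open WittVector Polynomial

theorem mul_teich_coeff {p : ℕ} [Fact p.Prime] {A : Type*} [CommRing A] [CharP A p] (n : ℕ) :
    ∀ (w : WittVector p A) (a : A), (w * teichmuller p a).coeff n = w.coeff n * a ^ p ^ n := by
  induction n with
  | zero => intro w a; simp [WittVector.mul_coeff_zero]
  | succ n ih =>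
    intro w a
    have hdis : ∀ (b : A) (v : WittVector p A) (k : ℕ),
        (teichmuller p b).coeff k = 0 ∨ (verschiebung v).coeff k = 0 := by
      intro b v k
      cases k with
      | zero => right; simp
      | succ k => left; exact teichmuller_coeff_pos p b _ (Nat.succ_pos k)
    have hw : w = teichmuller p (w.coeff 0) + verschiebung (w.shift 1) := by
      ext k
      rw [coeff_add_of_disjoint k _ _ (hdis _ _)]
      cases k with
      | zero => simp
      | succ k =>
        rw [teichmuller_coeff_pos p _ _ (Nat.succ_pos k), verschiebung_coeff_succ, zero_add,
          shift_coeff, add_comm]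
    have hF : frobenius (teichmuller p a) = teichmuller p (a ^ p) := by
      ext k
      rw [coeff_frobenius_charP]
      cases k with
      | zero => rw [teichmuller_coeff_zero, teichmuller_coeff_zero]
      | succ k =>
        rw [teichmuller_coeff_pos p _ _ (Nat.succ_pos k),
          teichmuller_coeff_pos p _ _ (Nat.succ_pos k), zero_pow (Fact.out : p.Prime).ne_zero]
    have h2 : w * teichmuller p a = teichmuller p (w.coeff 0 * a) +
        verschiebung (w.shift 1 * teichmuller p (a ^ p)) := by
      conv_lhs => rw [hw]
      rw [add_mul, ← map_mul, ← hF, verschiebung_mul_frobenius]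
    rw [h2, coeff_add_of_disjoint _ _ _ (hdis _ _), teichmuller_coeff_pos p _ _ (Nat.succ_pos n),
      verschiebung_coeff_succ, zero_add, ih, shift_coeff, add_comm 1 n, ← pow_mul, ← pow_succ']

/-- polynomials whose `k`-th coefficient lies in `F k` -/
def gsub {R : Type*} [CommRing R] (F : ℕ → AddSubgroup R) (h1 : (1 : R) ∈ F 0)
    (hm : ∀ i j a b, a ∈ F i → b ∈ F j → a * b ∈ F (i + j)) : Subring R[X] where
  carrier := {f | ∀ k, f.coeff k ∈ F k}
  mul_mem' := by
    intro f g hf hg k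
    rw [Polynomial.coeff_mul]
    refine sum_mem fun x hx => ?_
    rw [← Finset.HasAntidiagonal.mem_antidiagonal.1 hx]
    exact hm _ _ _ _ (hf _) (hg _)
  one_mem' := by
    intro k
    rw [Polynomial.coeff_one]
    split_ifs with h
    · rw [h]; exact h1
    · exact zero_mem _
  add_mem' := by
    intro f g hf hg k
    rw [Polynomial.coeff_add]; exact add_mem (hf k) (hg k)
  zero_mem' := by intro k; simp
  neg_mem' := by
    intro f hf k
    rw [Polynomial.coeff_neg]; exact neg_mem (hf k)

/-- Witt vectors with Teichmüller coordinates of degree `d` form an additive subgroup. -/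
noncomputable def V (p : ℕ) [Fact p.Prime] {R : Type*} [CommRing R] [CharP R p] (F : ℕ → AddSubgroup R)
    (h1 : (1 : R) ∈ F 0)
    (hm : ∀ i j a b, a ∈ F i → b ∈ F j → a * b ∈ F (i + j)) (d : ℕ) :
    AddSubgroup (WittVector p R) :=
  (((WittVector.map (gsub F h1 hm).subtype : WittVector p _ →+* WittVector p R[X]).range).toAddSubgroup).comap
    ((AddMonoidHom.mulRight (teichmuller p (X ^ d : R[X]))).comp
      (WittVector.map (C : R →+* R[X])).toAddMonoidHom)

theorem mem_V {p : ℕ} [Fact p.Prime] {R : Type*} [CommRing R] [CharP R p] {F : ℕ → AddSubgroup R}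
    {h1 : (1 : R) ∈ F 0}
    {hm : ∀ i j a b, a ∈ F i → b ∈ F j → a * b ∈ F (i + j)} {d : ℕ} {w : WittVector p R} :
    w ∈ V p F h1 hm d ↔ ∀ n, w.coeff n ∈ F (d * p ^ n) := by
  have hc : ∀ n, (WittVector.map (C : R →+* R[X]) w * teichmuller p (X ^ d : R[X])).coeff n =
      C (w.coeff n) * X ^ (d * p ^ n) := by
    intro n
    rw [mul_teich_coeff, map_coeff, pow_mul]
  have h0 : w ∈ V p F h1 hm d ↔ ∃ u, WittVector.map (gsub F h1 hm).subtype u =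
      WittVector.map (C : R →+* R[X]) w * teichmuller p (X ^ d : R[X]) := Iff.rfl
  rw [h0]
  constructor
  · rintro ⟨u, hu⟩ n
    have := congrArg (fun v => WittVector.coeff v n) hu
    simp only [hc, map_coeff] at this
    have h3 := (u.coeff n).2 (d * p ^ n)
    have h4 : ((u.coeff n : R[X])) = C (w.coeff n) * X ^ (d * p ^ n) := this
    rw [h4, coeff_C_mul_X_pow, if_pos rfl] at h3
    exact h3
  · intro h
    refine ⟨WittVector.mk p fun n => ⟨C (w.coeff n) * X ^ (d * p ^ n), ?_⟩, ?_⟩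
    · intro k
      rw [coeff_C_mul_X_pow]
      split_ifs with hk
      · rw [hk]; exact h n
      · exact zero_mem _
    · ext1 n
      rw [hc, map_coeff]
      rfl

/-- the homogeneous pieces -/
def F (p : ℕ) [Fact p.Prime] {R : Type*} [CommRing R] [CharP R p] (M : Submodule ℤ R) (k : ℕ) :
    AddSubgroup R where
  carrier := {f | ∃ n, ∀ l, n ≤ l → f ^ p ^ l ∈ M ^ (k * p ^ l)}
  zero_mem' := ⟨0, fun l _ => by
    rw [zero_pow (pow_ne_zero _ (Fact.out : p.Prime).ne_zero)]; exact zero_mem _⟩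
  add_mem' := by
    rintro a b ⟨n, hn⟩ ⟨l, hl⟩
    refine ⟨max n l, fun j hj => ?_⟩
    rw [add_pow_char_pow]
    exact add_mem (hn j (by omega)) (hl j (by omega))
  neg_mem' := by
    rintro a ⟨n, hn⟩
    refine ⟨n, fun j hj => ?_⟩
    have : (-a) ^ p ^ j = - a ^ p ^ j := by
      have := sub_pow_char_pow (p := p) (n := j) (0 : R) a
      rwa [zero_sub, zero_pow (pow_ne_zero _ (Fact.out : p.Prime).ne_zero), zero_sub] at this
    rw [this]
    exact neg_mem (hn j hj)

section
variable {p : ℕ} [Fact p.Prime] {R : Type*} [CommRing R] [CharP R p] {M : Submodule ℤ R}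

theorem mem_F {k : ℕ} {f : R} :
    f ∈ F p M k ↔ ∃ n, ∀ l, n ≤ l → f ^ p ^ l ∈ M ^ (k * p ^ l) := Iff.rfl

theorem mem_F_of {k n : ℕ} {f : R} (h : f ^ p ^ n ∈ M ^ (k * p ^ n)) : f ∈ F p M k := by
  refine ⟨n, fun l hl => ?_⟩
  obtain ⟨j, rfl⟩ := Nat.exists_eq_add_of_le hl
  rw [pow_add p, pow_mul f, ← mul_assoc, pow_mul M (k * p ^ n)]
  exact Submodule.pow_mem_pow _ h _

theorem one_mem_F : (1 : R) ∈ F p M 0 := mem_F_of (n := 0) (by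
  simp only [pow_zero, zero_mul, one_pow]; exact Submodule.one_le.1 le_rfl)

theorem mul_mem_F (i j : ℕ) (a b : R) (ha : a ∈ F p M i) (hb : b ∈ F p M j) :
    a * b ∈ F p M (i + j) := by
  obtain ⟨n, hn⟩ := ha
  obtain ⟨l, hl⟩ := hb
  refine ⟨max n l, fun k hk => ?_⟩
  rw [mul_pow, add_mul, pow_add]
  exact Submodule.mul_mem_mul (hn k (by omega)) (hl k (by omega))

theorem root_mem_F {k : ℕ} {g : R} (h : g ^ p ∈ F p M (k * p)) : g ∈ F p M k := by
  obtain ⟨n, hn⟩ := h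
  have := hn n le_rfl
  rw [← pow_mul, mul_assoc, ← pow_succ'] at this
  exact mem_F_of this

end

/-- pigeonhole -/
theorem pigeon {R : Type*} [CommRing R] (m q : ℕ) (y : Fin (m + 1) → R) (f : R)
    (hf : f ∈ Submodule.span ℤ (Set.range y) ^ ((m + 1) * q)) :
    ∃ b : Fin (m + 1) → R, (∀ i, b i ∈ Submodule.span ℤ (Set.range y) ^ (m * q)) ∧
      f = ∑ i, y i ^ q * b i := by
  classical
  set M := Submodule.span ℤ (Set.range y) with hM
  rw [hM, Submodule.span_pow] at hf
  induction hf using Submodule.span_induction with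
  | zero => exact ⟨0, fun i => zero_mem _, by simp⟩
  | add u v _ _ hu hv =>
    obtain ⟨b, hb, rfl⟩ := hu
    obtain ⟨c, hc, rfl⟩ := hv
    exact ⟨b + c, fun i => add_mem (hb i) (hc i), by simp [mul_add, Finset.sum_add_distrib]⟩
  | smul r u _ hu =>
    obtain ⟨b, hb, rfl⟩ := hu
    exact ⟨r • b, fun i => Submodule.smul_mem _ _ (hb i), by
      simp only [Finset.smul_sum, Pi.smul_apply, mul_smul_comm]⟩
  | mem u hu =>
    obtain ⟨g, rfl⟩ := Set.mem_pow.1 hu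
    choose e he using fun j => (g j).2
    obtain ⟨i, hi⟩ := Fintype.exists_le_card_fiber_of_mul_le_card (n := q) e (by simp)
    obtain ⟨T, hT, hTq⟩ := Finset.exists_subset_card_eq hi
    have hprod : (List.ofFn fun j => (g j : R)).prod = y i ^ q * ∏ j ∈ Tᶜ, (g j : R) := by
      rw [List.prod_ofFn, ← Finset.prod_mul_prod_compl T]
      congr 1
      refine (Finset.prod_eq_pow_card (b := y i) fun j hj => ?_).trans (by rw [hTq])
      rw [← he j, (Finset.mem_filter.1 (hT hj)).2]
    refine ⟨Pi.single i (∏ j ∈ Tᶜ, (g j : R)), fun k => ?_, ?_⟩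
    · rcases eq_or_ne k i with rfl | hk
      · rw [Pi.single_eq_same]
        have hcard : Tᶜ.card = m * q := by
          rw [Finset.card_compl, hTq, Fintype.card_fin, add_mul, one_mul, Nat.add_sub_cancel]
        rw [← hcard]
        have key : ∀ U : Finset (Fin ((m + 1) * q)), ∏ j ∈ U, (g j : R) ∈ M ^ U.card := by
          intro U
          induction U using Finset.induction_on with
          | empty => simp only [Finset.prod_empty, Finset.card_empty, pow_zero]
                     exact Submodule.one_le.1 le_rfl
          | insert a U ha ih =>
            rw [Finset.prod_insert ha, Finset.card_insert_of_notMem ha, pow_succ']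
            exact Submodule.mul_mem_mul (Submodule.subset_span (g a).2) ih
        exact key _
      · rw [Pi.single_eq_of_ne hk]; exact zero_mem _
    · rw [hprod, Finset.sum_eq_single i]
      · simp
      · intro k _ hk; simp [Pi.single_eq_of_ne hk]
      · simp

theorem bound {R : Type*} [CommRing R] (nm : R → ℝ) (hnonneg : ∀ x, 0 ≤ nm x)
    (heq0 : ∀ x, nm x = 0 ↔ x = 0)
    (hna : ∀ x y, nm (x - y) ≤ max (nm x) (nm y))
    (hsm : ∀ x y, nm (x * y) ≤ nm x * nm y)
    (hpm : ∀ (x : R) (n : ℕ), 1 ≤ n → nm (x ^ n) = nm x ^ n)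
    {ι : Type*} (y : ι → R) (B : ℝ) (hB : 1 ≤ B) (hy : ∀ i, nm (y i) ≤ B) (n : ℕ) (f : R)
    (hf : f ∈ Submodule.span ℤ (Set.range y) ^ n) : nm f ≤ B ^ n := by
  have hn0 : nm 0 = 0 := (heq0 0).2 rfl
  have hneg : ∀ a, nm (-a) ≤ nm a := fun a => by
    have := hna 0 a
    rwa [zero_sub, hn0, max_eq_right (hnonneg a)] at this
  have hadd : ∀ a b, nm (a + b) ≤ max (nm a) (nm b) := fun a b => by
    have := hna a (-b)
    rw [sub_neg_eq_add] at this
    exact this.trans (max_le_max le_rfl (hneg b))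
  have h1 : nm 1 ≤ 1 := by
    have := hpm 1 2 (by norm_num)
    rw [one_pow] at this
    nlinarith [hnonneg 1]
  have hB0 : 0 ≤ B := by linarith
  let G : ℕ → AddSubgroup R := fun n =>
    { carrier := {f | nm f ≤ B ^ n}
      zero_mem' := by simp only [Set.mem_ofPred_eq, hn0]; positivity
      add_mem' := fun {a b} ha hb => (hadd a b).trans (max_le ha hb)
      neg_mem' := fun {a} ha => (hneg a).trans ha }
  have hle : Submodule.span ℤ (Set.range y) ≤ AddSubgroup.toIntSubmodule (G 1) := by
    rw [Submodule.span_le]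
    rintro _ ⟨i, rfl⟩
    show nm (y i) ≤ B ^ 1
    rw [pow_one]; exact hy i
  have : ∀ n, Submodule.span ℤ (Set.range y) ^ n ≤ AddSubgroup.toIntSubmodule (G n) := by
    intro n
    induction n with
    | zero =>
      rw [pow_zero, Submodule.one_le]
      show nm 1 ≤ B ^ 0
      simpa using h1
    | succ n ih =>
      rw [pow_succ, Submodule.mul_le]
      intro a ha b hb
      have h2 : nm a ≤ B ^ n := ih ha
      have h3 : nm b ≤ B ^ 1 := hle hb
      show nm (a * b) ≤ B ^ (n + 1)
      calc nm (a * b) ≤ nm a * nm b := hsm _ _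
        _ ≤ B ^ n * B ^ 1 := mul_le_mul h2 h3 (hnonneg _) (by positivity)
        _ = B ^ (n + 1) := by ring
  exact this n hf

end S15

/-- For `(R, R⁺)` an analytic perfectoid pair of characteristic `p`, with
topologically nilpotent `x₀,…,x_m` generating the unit ideal of `R`, the
Teichmüller lifts `[x₀],…,[x_m]` generate the unit ideal of `W^b(R)`:
`1 = ∑ c_i [x_i]` with each `c_i` having bounded Teichmüller coordinates. -/
theorem stmt15 (p : ℕ) [Fact p.Prime] {R : Type*} [CommRing R] [CharP R p]
    (nm : R → ℝ) (hnonneg : ∀ x, 0 ≤ nm x) (heq0 : ∀ x, nm x = 0 ↔ x = 0)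
    (hna : ∀ x y, nm (x - y) ≤ max (nm x) (nm y))
    (hsm : ∀ x y, nm (x * y) ≤ nm x * nm y)
    (hpm : ∀ (x : R) (n : ℕ), 1 ≤ n → nm (x ^ n) = nm x ^ n)
    (hperf : Function.Bijective fun x : R => x ^ p)
    (m : ℕ) (x : Fin (m + 1) → R)
    (htopnilp : ∀ i, Tendsto (fun n : ℕ => nm (x i ^ n)) atTop (nhds 0))
    (hspan : Ideal.span (Set.range x) = ⊤) :
    ∃ c : Fin (m + 1) → WittVector p R,
      (∀ i, BddTeich p nm (c i)) ∧
      ∑ i, c i * WittVector.teichmuller p (x i) = 1 := by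
  classical
  have hp : p.Prime := Fact.out
  have : PerfectRing R p := ⟨hperf⟩
  have hinj : ∀ n, Function.Injective fun z : R => z ^ p ^ n := by
    intro n
    induction n with
    | zero => intro a b h; simpa using h
    | succ n ih =>
      intro a b h
      simp only [pow_succ, pow_mul] at h
      exact ih (hperf.1 h)
  have h1 : (1 : R) ∈ Ideal.span (Set.range x) := hspan ▸ Submodule.mem_top
  obtain ⟨a, ha⟩ := (Ideal.mem_span_range_iff_exists_fun).1 h1
  set y : Fin (m + 1) → R := fun i => a i * x i with hydef
  set M := Submodule.span ℤ (Set.range y) with hM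
  have hyM : ∀ i, y i ∈ M := fun i => Submodule.subset_span ⟨i, rfl⟩
  obtain ⟨B, hB1, hBy⟩ : ∃ B : ℝ, 1 ≤ B ∧ ∀ i, nm (y i) ≤ B := by
    refine ⟨1 + ∑ i, nm (y i), ?_, fun i => ?_⟩
    · linarith [Finset.sum_nonneg fun i (_ : i ∈ Finset.univ) => hnonneg (y i)]
    · linarith [Finset.single_le_sum (fun i _ => hnonneg (y i)) (Finset.mem_univ i)]
  obtain ⟨A, hA⟩ : ∃ A : ℝ, ∀ i, nm (a i) ≤ A :=
    ⟨∑ i, nm (a i), fun i => Finset.single_le_sum (fun i _ => hnonneg (a i)) (Finset.mem_univ i)⟩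
  have hFb : ∀ b ∈ S15.F p M m, nm b ≤ B ^ m := by
    rintro b ⟨n, hn⟩
    have hq : 1 ≤ p ^ n := Nat.one_le_pow _ _ hp.pos
    have := S15.bound nm hnonneg heq0 hna hsm hpm y B hB1 hBy _ _ (hn n le_rfl)
    rw [hpm _ _ hq, pow_mul] at this
    exact le_of_pow_le_pow_left₀ (by omega) (by positivity) this
  have hdec : ∀ f ∈ S15.F p M (m + 1), ∃ b : Fin (m + 1) → R, (∀ i, b i ∈ S15.F p M m) ∧
      f = ∑ i, y i * b i := by
    rintro f ⟨n, hn⟩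
    obtain ⟨b, hb, hfb⟩ := S15.pigeon m (p ^ n) y _ (hn n le_rfl)
    have hsurj : Function.Surjective fun z : R => z ^ p ^ n := by
      have := (bijective_iterateFrobenius R p n).2
      intro z
      obtain ⟨u, hu⟩ := this z
      exact ⟨u, by rw [← hu, iterateFrobenius_def]⟩
    choose c hc using fun i => hsurj (b i)
    refine ⟨c, fun i => S15.mem_F_of (n := n) ?_, hinj n ?_⟩
    · have := hc i
      simp only at this
      rw [this]; exact hb i
    · simp only at hc ⊢
      rw [hfb, sum_pow_char_pow]
      exact Finset.sum_congr rfl fun i _ => by rw [mul_pow (y i), hc]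
  let W := S15.V p (S15.F p M) S15.one_mem_F S15.mul_mem_F (m + 1)
  have hyF : ∀ i, y i ∈ S15.F p M 1 := fun i => S15.mem_F_of (n := 0) (by simpa using hyM i)
  have hteich : ∀ z ∈ S15.F p M (m + 1), WittVector.teichmuller p z ∈ W := by
    intro z hz
    refine S15.mem_V.2 fun n => ?_
    cases n with
    | zero => simpa using hz
    | succ n => rw [WittVector.teichmuller_coeff_pos p _ _ (Nat.succ_pos n)]; exact zero_mem _
  have hone : (1 : WittVector p R) ∈ W := by
    rw [← map_one (WittVector.teichmuller p)]
    refine hteich _ (S15.mem_F_of (n := 0) ?_)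
    have h1M : (1 : R) ∈ M := by
      rw [← ha]
      exact sum_mem fun i _ => hyM i
    have := Submodule.pow_mem_pow M h1M (m + 1)
    simpa using this
  have hstep : ∀ w : W, ∃ (b : Fin (m + 1) → R) (w' : W), (∀ i, b i ∈ S15.F p M m) ∧
      (w : WittVector p R) = ∑ i, WittVector.teichmuller p (y i * b i) + w' * p := by
    rintro ⟨w, hw⟩
    obtain ⟨b, hb, hwb⟩ := hdec (w.coeff 0) (by simpa using S15.mem_V.1 hw 0)
    have hu : w - ∑ i, WittVector.teichmuller p (y i * b i) ∈ W := by
      refine sub_mem hw (sum_mem fun i _ => hteich _ ?_)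
      rw [add_comm]
      exact S15.mul_mem_F _ _ _ _ (hyF i) (hb i)
    set u := w - ∑ i, WittVector.teichmuller p (y i * b i) with hudef
    have hu0 : u.coeff 0 = 0 := by
      have : WittVector.constantCoeff u = 0 := by
        rw [hudef, map_sub, map_sum]
        simp only [WittVector.constantCoeff_apply, hwb, WittVector.teichmuller_coeff_zero, sub_self]
      simpa [WittVector.constantCoeff_apply] using this
    choose r hr using fun n => hperf.2 (u.coeff (n + 1))
    simp only at hr
    have hup : u = WittVector.mk p r * p := by
      ext n
      cases n with
      | zero => rw [hu0, WittVector.mul_charP_coeff_zero]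
      | succ n => rw [WittVector.mul_charP_coeff_succ, WittVector.coeff_mk, hr]
    refine ⟨b, ⟨WittVector.mk p r, S15.mem_V.2 fun n => ?_⟩, hb, ?_⟩
    · rw [WittVector.coeff_mk]
      refine S15.root_mem_F ?_
      rw [hr, mul_assoc, ← pow_succ]
      exact S15.mem_V.1 hu (n + 1)
    · show w = _ + WittVector.mk p r * p
      rw [← hup, hudef]; ring
  choose b next hb hnext using hstep
  let s : ℕ → W := fun n => next^[n] ⟨1, hone⟩
  have hs : ∀ n, s (n + 1) = next (s n) := fun n => Function.iterate_succ_apply' _ _ _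
  have hsum : ∀ N, (1 : WittVector p R) = ∑ n ∈ Finset.range N,
      (∑ i, WittVector.teichmuller p (y i * b (s n) i)) * p ^ n + (s N : WittVector p R) * p ^ N := by
    intro N
    induction N with
    | zero => simp [s]
    | succ N ih =>
      rw [Finset.sum_range_succ, add_assoc]
      have : (∑ i, WittVector.teichmuller p (y i * b (s N) i)) * (p : WittVector p R) ^ N +
          (s (N + 1) : WittVector p R) * p ^ (N + 1) = s N * p ^ N := by
        conv_rhs => rw [hnext (s N)]
        rw [hs]; ring
      rw [this]; exact ih
  let c : Fin (m + 1) → WittVector p R := fun i =>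
    WittVector.mk p fun n => (b (s n) i * a i) ^ p ^ n
  have hcdvd : ∀ i N, (p : WittVector p R) ^ (N + 1) ∣ c i - ∑ n ∈ Finset.range (N + 1),
      WittVector.teichmuller p (b (s n) i * a i) * p ^ n := by
    intro i N
    have := WittVector.dvd_sub_sum_teichmuller_iterateFrobeniusEquiv_coeff (c i) N
    have h2 : ∀ n, ((frobeniusEquiv R p).symm ^ n) ((c i).coeff n) = b (s n) i * a i := by
      intro n
      have h3 : ∀ (n : ℕ) (z : R), ((frobeniusEquiv R p).symm ^ n) (z ^ p ^ n) = z := by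
        intro n
        induction n with
        | zero => intro z; simp
        | succ n ih =>
          intro z
          rw [pow_succ', pow_succ, pow_mul, RingAut.mul_apply, map_pow, ih]
          exact (frobeniusEquiv R p).symm_apply_apply z
      exact h3 n _
    simp only [h2] at this
    rwa [← Nat.range_succ_eq_Iic] at this
  refine ⟨c, fun i => ⟨B ^ m * A, fun n => ⟨b (s n) i * a i, rfl, ?_⟩⟩, ?_⟩
  · exact (hsm _ _).trans (mul_le_mul (hFb _ (hb _ i)) (hA i) (hnonneg _) (by positivity))
  · have hdvd : ∀ N, (p : WittVector p R) ^ (N + 1) ∣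
        ∑ i, c i * WittVector.teichmuller p (x i) - 1 := by
      intro N
      have e : ∑ i, c i * WittVector.teichmuller p (x i) - 1 =
          ∑ i, (c i - ∑ n ∈ Finset.range (N + 1),
            WittVector.teichmuller p (b (s n) i * a i) * p ^ n) * WittVector.teichmuller p (x i)
          - (s (N + 1) : WittVector p R) * p ^ (N + 1) := by
        have h4 : ∑ n ∈ Finset.range (N + 1),
            (∑ i, WittVector.teichmuller p (y i * b (s n) i)) * (p : WittVector p R) ^ n =
            ∑ i, (∑ n ∈ Finset.range (N + 1),
            WittVector.teichmuller p (b (s n) i * a i) * p ^ n) * WittVector.teichmuller p (x i) := by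
          simp only [Finset.sum_mul]
          rw [Finset.sum_comm]
          refine Finset.sum_congr rfl fun i _ => Finset.sum_congr rfl fun n _ => ?_
          simp only [hydef, map_mul]; ring
        have h5 := hsum (N + 1)
        rw [h4] at h5
        conv_lhs => rw [h5]
        simp only [sub_mul, Finset.sum_sub_distrib]
        ring
      rw [e]
      exact dvd_sub (Finset.dvd_sum fun i _ => (hcdvd i N).mul_right _) (dvd_mul_left _ _)
    rw [← sub_eq_zero]
    ext n
    obtain ⟨v, hv⟩ := hdvd n
    rw [hv, mul_comm, WittVector.mul_pow_charP_coeff_zero _ (Nat.lt_succ_self n),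
      WittVector.zero_coeff]
end

section
/- Let S be a perfect uniform Banach ring of characteristic p with power-multiplicative norm, and let z = [z̄_0] + p z_1 ∈ W(S⁺) be a primitive element (z̄_0 topologically nilpotent and z_1 a unit of W(S⁺)). Then the quotient seminorm on W^b(S)/(z) induced by the Gauss norm on W^b(S) is power-multiplicative; if moreover the norm on S is multiplicative, the quotient norm on W^b(S)/(z) is multiplicative. -/
open Filter

/-- `w` has Teichmüller coordinates of norm at most `C`. -/
def TeichBddBy (p : ℕ) [Fact p.Prime] {S : Type*} [CommRing S] (nm : S → ℝ) (C : ℝ)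
    (w : WittVector p S) : Prop :=
  ∀ n : ℕ, ∃ y : S, y ^ p ^ n = w.coeff n ∧ nm y ≤ C


namespace W18
open WittVector

theorem mem_add {p : ℕ} [Fact p.Prime] {R : Type*} [CommRing R] (B : Subring R)
    (x y : WittVector p R) (hx : ∀ n, x.coeff n ∈ B) (hy : ∀ n, y.coeff n ∈ B) :
    (∀ n, (x + y).coeff n ∈ B) ∧ (∀ n, (x * y).coeff n ∈ B) ∧ (∀ n, (-x).coeff n ∈ B) := by
  let x' : WittVector p B := WittVector.mk p fun n => ⟨x.coeff n, hx n⟩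
  let y' : WittVector p B := WittVector.mk p fun n => ⟨y.coeff n, hy n⟩
  have ex : WittVector.map B.subtype x' = x := by ext n; simp [x', WittVector.map_coeff]
  have ey : WittVector.map B.subtype y' = y := by ext n; simp [y', WittVector.map_coeff]
  refine ⟨fun n => ?_, fun n => ?_, fun n => ?_⟩
  · rw [← ex, ← ey, ← map_add, WittVector.map_coeff]; exact Subtype.property _
  · rw [← ex, ← ey, ← map_mul, WittVector.map_coeff]; exact Subtype.property _
  · rw [← ex, ← map_neg, WittVector.map_coeff]; exact Subtype.property _

theorem add_shift {p : ℕ} [Fact p.Prime] {R : Type*} [CommRing R] (x : WittVector p R) :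
    x = teichmuller p (x.coeff 0) + verschiebung (x.shift 1) := by
  ext n
  rw [WittVector.coeff_add_of_disjoint]
  · cases n with
    | zero => simp
    | succ n => 
      rw [teichmuller_coeff_pos _ _ _ (Nat.succ_pos n), verschiebung_coeff_succ, shift_coeff]
      simp [add_comm]
  · intro n
    cases n with
    | zero => right; simp
    | succ n => left; exact teichmuller_coeff_pos _ _ _ (Nat.succ_pos n)

theorem teich_mul_coeff {p : ℕ} [Fact p.Prime] {R : Type*} [CommRing R] [CharP R p]
    (n : ℕ) : ∀ (a : R) (x : WittVector p R), 
    (teichmuller p a * x).coeff n = a ^ p ^ n * x.coeff n := by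
  induction n with
  | zero => intro a x; simp [WittVector.mul_coeff_zero]
  | succ n ih =>
    intro a x
    have h : teichmuller p a * x = teichmuller p (a * x.coeff 0) + 
        verschiebung (teichmuller p (a ^ p) * x.shift 1) := by
      conv_lhs => rw [add_shift x]
      rw [mul_add, map_mul]
      congr 1
      rw [mul_comm, ← verschiebung_mul_frobenius, frobenius_eq_map_frobenius, map_teichmuller,
        mul_comm]
      rfl
    rw [h, WittVector.coeff_add_of_disjoint]
    · rw [teichmuller_coeff_pos _ _ _ (Nat.succ_pos n), verschiebung_coeff_succ, ih, shift_coeff]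
      rw [← pow_mul, ← pow_succ', zero_add, add_comm 1 n]
    · intro n
      cases n with
      | zero => right; simp
      | succ n => left; exact teichmuller_coeff_pos _ _ _ (Nat.succ_pos n)

open MonoidAlgebra in
theorem bounds {p : ℕ} [Fact p.Prime] {S : Type*} [CommRing S] [CharP S p]
    (nm : S → ℝ) (hnonneg : ∀ s, 0 ≤ nm s) (heq0 : ∀ s, nm s = 0 ↔ s = 0)
    (hna : ∀ s t, nm (s - t) ≤ max (nm s) (nm t))
    (hsm : ∀ s t, nm (s * t) ≤ nm s * nm t) (h1 : nm 1 ≤ 1)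
    (C D : NNReal) (x y : WittVector p S) (hx : ∀ n, nm (x.coeff n) ≤ C ^ p ^ n) :
    ((∀ n, nm (y.coeff n) ≤ C ^ p ^ n) → ∀ n, nm ((x + y).coeff n) ≤ C ^ p ^ n) ∧
    ((∀ n, nm (y.coeff n) ≤ D ^ p ^ n) → ∀ n, nm ((x * y).coeff n) ≤ (C * D) ^ p ^ n) ∧
    (∀ n, nm ((-x).coeff n) ≤ C ^ p ^ n) := by
  have h0 : nm 0 = 0 := (heq0 0).2 rfl
  have hneg : ∀ s, nm (-s) ≤ nm s := fun s => by
    have := hna 0 s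
    rw [h0, zero_sub, max_eq_right (hnonneg s)] at this
    exact this
  have hadd : ∀ s t, nm (s + t) ≤ max (nm s) (nm t) := fun s t => by
    have := hna s (-t)
    rw [sub_neg_eq_add] at this
    exact this.trans (max_le_max le_rfl (hneg t))
  have hsum : ∀ {ι : Type} (s : Finset ι) (f : ι → S) (r : ℝ), 0 ≤ r → (∀ i ∈ s, nm (f i) ≤ r) →
      nm (∑ i ∈ s, f i) ≤ r := by
    intro ι s f r hr h
    exact Finset.sum_induction f (fun a => nm a ≤ r)
      (fun a b ha hb => (hadd a b).trans (max_le ha hb)) (by simpa [h0] using hr) h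
  have hsingle : ∀ (r : NNReal) (s : S), nm s ≤ r → ∀ t : NNReal, 
      nm ((single r s : MonoidAlgebra S NNReal).coeff t) ≤ t := by
    intro r s h t
    rw [coeff_single, Finsupp.single_apply]
    split_ifs with e
    · rwa [← e]
    · rw [h0]; exact t.2
  let B : Subring (MonoidAlgebra S NNReal) :=
    { carrier := {f | ∀ r, nm (f.coeff r) ≤ r}
      zero_mem' := fun r => by simp [h0]
      one_mem' := by
        intro r
        rw [one_def]
        exact hsingle 1 1 (by simpa using h1) r
      add_mem' := fun {f g} hf hg r => by
        rw [coeff_add]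
        exact (hadd _ _).trans (max_le (hf r) (hg r))
      neg_mem' := fun {f} hf r => by
        rw [coeff_neg]
        exact (hneg _).trans (hf r)
      mul_mem' := fun {f g} hf hg r => by
        classical
        rw [coeff_mul]
        unfold Finsupp.sum
        refine hsum _ _ _ r.2 fun i _ => hsum _ _ _ r.2 fun j _ => ?_
        beta_reduce
        split_ifs with e
        · rw [← e, NNReal.coe_mul]
          exact (hsm _ _).trans (mul_le_mul (hf i) (hg j) (hnonneg _) i.2)
        · rw [h0]; exact r.2 }
  let ι : S →+* MonoidAlgebra S NNReal := singleOneRingHom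
  have hι : ∀ s, ι s = single 1 s := fun s => rfl
  have hinj : Function.Injective ι := by
    intro a b h
    have := congrArg (fun f => MonoidAlgebra.coeff f 1) h
    simpa [hι] using this
  have : CharP (MonoidAlgebra S NNReal) p := charP_of_injective_ringHom hinj p
  have key : ∀ (C : NNReal) (x : WittVector p S) (n : ℕ), 
      (teichmuller p (single C 1) * WittVector.map ι x).coeff n = single (C ^ p ^ n) (x.coeff n) := by
    intro C x n
    rw [teich_mul_coeff, map_coeff, hι, single_pow, single_mul_single]
    simp
  have lift : ∀ (C : NNReal) (x : WittVector p S), (∀ n, nm (x.coeff n) ≤ C ^ p ^ n) ↔ 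
      ∀ n, (teichmuller p (single C 1) * WittVector.map ι x).coeff n ∈ B := by
    intro C x
    refine forall_congr' fun n => ?_
    rw [key]
    constructor
    · intro h
      exact hsingle _ _ (by simpa using h)
    · intro h
      simpa using h (C ^ p ^ n)
  refine ⟨fun hy => ?_, fun hy => ?_, ?_⟩
  · rw [lift] at hx hy ⊢
    rw [map_add, mul_add]
    exact (mem_add B _ _ hx hy).1
  · have := lift (C * D) (x * y)
    rw [NNReal.coe_mul] at this
    rw [this]
    rw [lift] at hx hy
    have := (mem_add B _ _ hx hy).2.1
    have e : (single (C * D) 1 : MonoidAlgebra S NNReal) = single C 1 * single D 1 := by 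
      rw [single_mul_single, one_mul]
    rw [e, map_mul, map_mul, mul_mul_mul_comm]
    exact this
  · rw [lift] at hx ⊢
    rw [map_neg, mul_neg]
    exact (mem_add B _ _ hx hx).2.2


/-- coefficient bound -/
def PB (p : ℕ) [Fact p.Prime] {S : Type*} [CommRing S] (nm : S → ℝ) (C : ℝ)
    (w : WittVector p S) : Prop := 0 ≤ C ∧ ∀ n, nm (w.coeff n) ≤ C ^ p ^ n

/-- boundedness -/
def Bd (p : ℕ) [Fact p.Prime] {S : Type*} [CommRing S] (nm : S → ℝ)
    (w : WittVector p S) : Prop := ∃ C, PB p nm C w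

theorem main (p : ℕ) [Fact p.Prime] {S : Type*} [CommRing S] [CharP S p]
    (nm : S → ℝ) (hnonneg : ∀ s, 0 ≤ nm s) (heq0 : ∀ s, nm s = 0 ↔ s = 0)
    (hna : ∀ s t, nm (s - t) ≤ max (nm s) (nm t))
    (hsm : ∀ s t, nm (s * t) ≤ nm s * nm t)
    (hpm : ∀ (s : S) (n : ℕ), 1 ≤ n → nm (s ^ n) = nm s ^ n)
    (hperf : Function.Bijective fun s : S => s ^ p)
    (z z₁ z₁' : WittVector p S) (z₀ : S)
    (hz : z = WittVector.teichmuller p z₀ + p * z₁)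
    (hz₀ : nm z₀ < 1)
    (hz₁ : PB p nm 1 z₁) (hz₁' : PB p nm 1 z₁') (hzz : z₁ * z₁' = 1)
    (G Q : WittVector p S → ℝ)
    (hG1 : ∀ w, Bd p nm w → PB p nm (G w) w)
    (hG2 : ∀ w C, PB p nm C w → G w ≤ C)
    (hQ : ∀ w, Q w = sInf {r : ℝ | ∃ y : WittVector p S, Bd p nm y ∧ G (w + z * y) = r}) :
    (∀ w : WittVector p S, Bd p nm w → ∀ n : ℕ, 1 ≤ n → Q (w ^ n) = Q w ^ n) ∧
    ((∀ s t : S, nm (s * t) = nm s * nm t) →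
      ∀ w w' : WittVector p S, Bd p nm w → Bd p nm w' → Q (w * w') = Q w * Q w') := by
  have hp := (Fact.out : p.Prime)
  have h0 : nm 0 = 0 := (heq0 0).2 rfl
  have h1 : nm 1 ≤ 1 := by
    have h := hpm 1 2 (by norm_num)
    rw [one_pow] at h
    by_contra hc
    nlinarith
  have hadd : ∀ s t, nm (s + t) ≤ max (nm s) (nm t) := fun s t => by
    have hn : nm (-t) ≤ nm t := by
      have := hna 0 t
      rwa [h0, zero_sub, max_eq_right (hnonneg t)] at this
    have := hna s (-t)
    rw [sub_neg_eq_add] at this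
    exact this.trans (max_le_max le_rfl hn)
  -- calculus of bounds
  have Pmono : ∀ {C D x}, PB p nm C x → C ≤ D → PB p nm D x := fun h hCD =>
    ⟨h.1.trans hCD, fun n => (h.2 n).trans (pow_le_pow_left₀ h.1 hCD _)⟩
  have Padd : ∀ {C x y}, PB p nm C x → PB p nm C y → PB p nm C (x + y) := fun {C x y} hx hy =>
    ⟨hx.1, (bounds nm hnonneg heq0 hna hsm h1 ⟨C, hx.1⟩ 0 x y hx.2).1 hy.2⟩
  have Pmul : ∀ {C D x y}, PB p nm C x → PB p nm D y → PB p nm (C * D) (x * y) :=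
    fun {C D x y} hx hy => ⟨mul_nonneg hx.1 hy.1,
      (bounds nm hnonneg heq0 hna hsm h1 ⟨C, hx.1⟩ ⟨D, hy.1⟩ x y hx.2).2.1 hy.2⟩
  have Pneg : ∀ {C x}, PB p nm C x → PB p nm C (-x) := fun {C x} hx =>
    ⟨hx.1, (bounds nm hnonneg heq0 hna hsm h1 ⟨C, hx.1⟩ 0 x 0 hx.2).2.2⟩
  have Psub : ∀ {C x y}, PB p nm C x → PB p nm C y → PB p nm C (x - y) := fun hx hy => by
    rw [sub_eq_add_neg]; exact Padd hx (Pneg hy)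
  have Pteich : ∀ a : S, PB p nm (nm a) (teichmuller p a) := fun a => by
    refine ⟨hnonneg a, fun n => ?_⟩
    cases n with
    | zero => simp
    | succ n =>
      rw [teichmuller_coeff_pos _ _ _ (Nat.succ_pos n), h0]
      exact pow_nonneg (hnonneg a) _
  have Pp : ∀ {C x}, 0 ≤ C → (PB p nm C (p * x) ↔ PB p nm C x) := by
    intro C x hC
    constructor
    · intro h
      refine ⟨hC, fun n => ?_⟩
      have := h.2 (n + 1)
      rw [mul_comm, mul_charP_coeff_succ, hpm _ _ hp.one_lt.le, pow_succ, pow_mul] at this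
      exact le_of_pow_le_pow_left₀ hp.ne_zero (pow_nonneg hC _) this
    · intro h
      refine ⟨hC, fun n => ?_⟩
      rw [mul_comm]
      cases n with
      | zero => rw [mul_charP_coeff_zero, h0]; exact pow_nonneg hC _
      | succ n =>
        rw [mul_charP_coeff_succ, hpm _ _ hp.one_lt.le, pow_succ, pow_mul]
        exact pow_le_pow_left₀ (hnonneg _) (h.2 n) _
  have P0 : PB p nm 0 (0 : WittVector p S) := by
    have := Pteich 0
    rwa [h0, teichmuller_zero] at this
  have P1 : PB p nm 1 (1 : WittVector p S) := by
    have := Pteich 1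
    rw [map_one] at this
    exact Pmono this h1
  have Badd : ∀ {x y}, Bd p nm x → Bd p nm y → Bd p nm (x + y) := by
    rintro x y ⟨C, hx⟩ ⟨D, hy⟩
    exact ⟨max C D, Padd (Pmono hx (le_max_left _ _)) (Pmono hy (le_max_right _ _))⟩
  have Bmul : ∀ {x y}, Bd p nm x → Bd p nm y → Bd p nm (x * y) := by
    rintro x y ⟨C, hx⟩ ⟨D, hy⟩
    exact ⟨_, Pmul hx hy⟩
  have Bneg : ∀ {x}, Bd p nm x → Bd p nm (-x) := by
    rintro x ⟨C, hx⟩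
    exact ⟨_, Pneg hx⟩
  have B0 : Bd p nm (0 : WittVector p S) := ⟨_, P0⟩
  have Bz : Bd p nm z := by
    rw [hz]; exact Badd ⟨_, Pteich z₀⟩ ⟨1, (Pp zero_le_one).2 hz₁⟩
  have Bpow : ∀ {x}, Bd p nm x → ∀ n : ℕ, Bd p nm (x ^ n) := by
    intro x hx n
    induction n with
    | zero => rw [pow_zero]; exact ⟨1, P1⟩
    | succ n ih => rw [pow_succ]; exact Bmul ih hx
  have Gnn : ∀ {w}, Bd p nm w → 0 ≤ G w := fun h => (hG1 _ h).1
  have P00 : ∀ {C w}, PB p nm C w → nm (w.coeff 0) ≤ C := fun h => by simpa using h.2 0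
  have zz0 : ∀ y : WittVector p S, (z * y).coeff 0 = z₀ * y.coeff 0 := by
    intro y
    rw [WittVector.mul_coeff_zero, hz, WittVector.add_coeff_zero, mul_comm (p : WittVector p S),
      mul_charP_coeff_zero, teichmuller_coeff_zero, add_zero]
  -- stable elements have minimal norm
  have keyA : ∀ x y, Bd p nm x → Bd p nm y → G x = nm (x.coeff 0) → G x ≤ G (x + z * y) := by
    intro x y hx hy hst
    by_contra! hlt
    have hxy : Bd p nm (x + z * y) := Badd hx (Bmul Bz hy)
    have hg := hG1 _ hxy
    have hc : G x ≤ nm z₀ * G y := by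
      have e : x.coeff 0 = (x + z * y).coeff 0 - z₀ * y.coeff 0 := by
        rw [WittVector.add_coeff_zero, zz0]; ring
      have h2 := hna ((x + z * y).coeff 0) (z₀ * y.coeff 0)
      rw [← e, ← hst] at h2
      have h3 : G x ≤ nm (z₀ * y.coeff 0) := by
        rcases le_max_iff.1 h2 with h | h
        · exact absurd (h.trans (P00 hg)) (not_le.2 hlt)
        · exact h
      exact h3.trans ((hsm _ _).trans (mul_le_mul_of_nonneg_left (P00 (hG1 y hy)) (hnonneg _)))
    have e2 : (p : WittVector p S) * (z₁ * y) = (x + z * y) - x - teichmuller p z₀ * y := by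
      rw [hz]; ring
    have h4 : PB p nm (nm z₀ * G y) (p * (z₁ * y)) := by
      rw [e2]
      exact Psub (Psub (Pmono hg (hlt.le.trans hc)) (Pmono (hG1 x hx) hc)) 
        (Pmul (Pteich z₀) (hG1 y hy))
    have h5 := Pmul hz₁' ((Pp h4.1).1 h4)
    have e3 : z₁' * (z₁ * y) = y := by rw [← mul_assoc, mul_comm z₁', hzz, one_mul]
    rw [e3, one_mul] at h5
    have h6 := hG2 _ _ h5
    have h7 := Gnn hy
    have h8 := Gnn hxy
    have h9 := hnonneg z₀
    nlinarith
  -- one step of the reduction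
  have step : ∀ x, Bd p nm x → ∃ y, Bd p nm y ∧ (G (x + z * y) = nm ((x + z * y).coeff 0) ∨
      G (x + z * y) ≤ nm z₀ * G x) := by
    intro x hx
    choose rt hrt using hperf.2
    simp only at hrt
    let x₁ : WittVector p S := WittVector.mk p fun n => rt (x.coeff (n + 1))
    have hx₁ : x = teichmuller p (x.coeff 0) + p * x₁ := by
      conv_lhs => rw [add_shift x]
      congr 1
      ext n
      rw [mul_comm]
      cases n with
      | zero => rw [mul_charP_coeff_zero, verschiebung_coeff_zero]
      | succ n =>
        rw [mul_charP_coeff_succ, verschiebung_coeff_succ, shift_coeff]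
        simp [x₁, hrt, add_comm]
    have hGx := hG1 x hx
    have P₁ : PB p nm (G x) x₁ := by
      refine ⟨hGx.1, fun n => ?_⟩
      have := hGx.2 (n + 1)
      rw [← hrt (x.coeff (n + 1)), hpm _ _ hp.one_lt.le, pow_succ, pow_mul] at this
      exact le_of_pow_le_pow_left₀ hp.ne_zero (pow_nonneg hGx.1 _) this
    have hy : PB p nm (G x) (-(z₁' * x₁)) := by
      have := Pneg (Pmul hz₁' P₁); rwa [one_mul] at this
    refine ⟨_, ⟨_, hy⟩, ?_⟩
    have e : x + z * (-(z₁' * x₁)) = 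
        teichmuller p (x.coeff 0) + teichmuller p z₀ * (-(z₁' * x₁)) := by
      conv_lhs => rw [hx₁, hz]
      linear_combination (-(p : WittVector p S) * x₁) * hzz
    have hm := Pmul (Pteich z₀) hy
    have e0 : (x + z * (-(z₁' * x₁))).coeff 0 = 
        x.coeff 0 + (teichmuller p z₀ * (-(z₁' * x₁))).coeff 0 := by
      rw [e, WittVector.add_coeff_zero, teichmuller_coeff_zero]
    generalize teichmuller p z₀ * (-(z₁' * x₁)) = u at *
    by_cases hcase : nm (x.coeff 0) ≤ nm z₀ * G x
    · right
      apply hG2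
      rw [e]
      exact Padd (Pmono (Pteich _) hcase) hm
    · left
      push Not at hcase
      have hle : PB p nm (nm (x.coeff 0)) (x + z * (-(z₁' * x₁))) := by
        rw [e]; exact Padd (Pteich _) (Pmono hm hcase.le)
      have hge : nm (x.coeff 0) ≤ nm ((x + z * (-(z₁' * x₁))).coeff 0) := by
        have h2 := hna ((x + z * (-(z₁' * x₁))).coeff 0) (u.coeff 0)
        rw [e0, add_sub_cancel_right, ← e0] at h2
        rcases le_max_iff.1 h2 with h | h
        · exact h
        · exact absurd (h.trans (P00 hm)) (not_le.2 hcase)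
      exact le_antisymm ((hG2 _ _ hle).trans hge) (P00 (hG1 _ ⟨_, hle⟩))
  have iter : ∀ x, Bd p nm x → (∃ y, Bd p nm y ∧ G (x + z * y) = nm ((x + z * y).coeff 0)) ∨
      ∀ k : ℕ, ∃ y, Bd p nm y ∧ G (x + z * y) ≤ nm z₀ ^ k * G x := by
    intro x hx
    by_cases hs : ∃ y, Bd p nm y ∧ G (x + z * y) = nm ((x + z * y).coeff 0)
    · exact Or.inl hs
    · right
      intro k
      induction k with
      | zero => exact ⟨0, B0, by simp⟩
      | succ k ih =>
        obtain ⟨y, hy, hk⟩ := ih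
        obtain ⟨y', hy', h⟩ := step (x + z * y) (Badd hx (Bmul Bz hy))
        have e : x + z * y + z * y' = x + z * (y + y') := by ring
        rw [e] at h
        refine ⟨y + y', Badd hy hy', ?_⟩
        rcases h with h | h
        · exact absurd ⟨_, Badd hy hy', h⟩ hs
        · refine h.trans ?_
          rw [pow_succ', mul_assoc]
          exact mul_le_mul_of_nonneg_left hk (hnonneg _)
  -- properties of Q
  have Qle : ∀ w y, Bd p nm w → Bd p nm y → Q w ≤ G (w + z * y) := by
    intro w y hw hy
    rw [hQ]
    refine csInf_le ⟨0, ?_⟩ ⟨y, hy, rfl⟩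
    rintro r ⟨y, hy, rfl⟩
    exact Gnn (Badd hw (Bmul Bz hy))
  have leQ : ∀ w c, (∀ y, Bd p nm y → c ≤ G (w + z * y)) → c ≤ Q w := by
    intro w c h
    rw [hQ]
    refine le_csInf ⟨_, 0, B0, rfl⟩ ?_
    rintro r ⟨y, hy, rfl⟩
    exact h y hy
  have Qnn : ∀ w, Bd p nm w → 0 ≤ Q w := fun w hw => leQ w 0 fun y hy => 
    Gnn (Badd hw (Bmul Bz hy))
  have Qst : ∀ x y, Bd p nm x → Bd p nm y → G (x + z * y) = nm ((x + z * y).coeff 0) → 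
      Q x = nm ((x + z * y).coeff 0) := by
    intro x y hx hy h
    apply le_antisymm
    · rw [← h]; exact Qle x y hx hy
    · apply leQ
      intro y' hy'
      have := keyA (x + z * y) (y' + -y) (Badd hx (Bmul Bz hy)) (Badd hy' (Bneg hy)) h
      rw [← h]
      convert this using 2
      ring
  have dich : ∀ x, Bd p nm x → (∃ y, Bd p nm y ∧ G (x + z * y) = nm ((x + z * y).coeff 0)) ∨
      (Q x = 0 ∧ ∀ v, Bd p nm v → Q (x * v) = 0) := by
    intro x hx
    rcases iter x hx with h | h
    · exact Or.inl h
    · right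
      have hv : ∀ v, Bd p nm v → Q (x * v) = 0 := by
        intro v hv
        refine le_antisymm ?_ (Qnn _ (Bmul hx hv))
        have hk : ∀ k : ℕ, Q (x * v) ≤ nm z₀ ^ k * (G x * G v) := by
          intro k
          obtain ⟨y, hy, hk⟩ := h k
          have h1 := Qle (x * v) (y * v) (Bmul hx hv) (Bmul hy hv)
          have e : x * v + z * (y * v) = (x + z * y) * v := by ring
          rw [e] at h1
          refine h1.trans ((hG2 _ _ (Pmul (hG1 _ (Badd hx (Bmul Bz hy))) (hG1 _ hv))).trans ?_)
          rw [← mul_assoc]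
          exact mul_le_mul_of_nonneg_right hk (Gnn hv)
        have ht : Tendsto (fun k : ℕ => nm z₀ ^ k * (G x * G v)) atTop (nhds (0 * (G x * G v))) :=
          (tendsto_pow_atTop_nhds_zero_of_lt_one (hnonneg _) hz₀).mul_const _
        rw [zero_mul] at ht
        exact ge_of_tendsto' ht hk
      refine ⟨?_, hv⟩
      have := hv 1 ⟨1, P1⟩
      rwa [mul_one] at this
  constructor
  · intro w hw n hn
    rcases dich w hw with ⟨y, hy, h⟩ | ⟨h, hv⟩
    · have hE : ∀ n : ℕ, (∃ y', Bd p nm y' ∧ (w + z * y) ^ n = w ^ n + z * y') ∧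
          PB p nm (nm ((w + z * y).coeff 0) ^ n) ((w + z * y) ^ n) ∧
          ((w + z * y) ^ n).coeff 0 = (w + z * y).coeff 0 ^ n := by
        intro n
        induction n with
        | zero => 
          refine ⟨⟨0, B0, by simp⟩, ?_, ?_⟩
          · simpa using P1
          · simp
        | succ n ih =>
          obtain ⟨⟨y', hy', e⟩, hP, hc⟩ := ih
          refine ⟨⟨w ^ n * y + y' * (w + z * y), ?_, ?_⟩, ?_, ?_⟩
          · exact Badd (Bmul (Bpow hw n) hy) (Bmul hy' (Badd hw (Bmul Bz hy)))
          · rw [pow_succ, e]; ring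
          · rw [pow_succ, pow_succ]
            refine Pmul hP ?_
            rw [← h]
            exact hG1 _ (Badd hw (Bmul Bz hy))
          · rw [pow_succ, WittVector.mul_coeff_zero, hc, pow_succ]
      obtain ⟨⟨y', hy', e⟩, hP, hc⟩ := hE n
      rw [Qst w y hw hy h, ← hpm _ _ hn, ← hc, e]
      apply Qst _ _ (Bpow hw n) hy'
      rw [← e]
      apply le_antisymm _ (P00 (hG1 _ ⟨_, hP⟩))
      rw [hc, hpm _ _ hn]
      exact hG2 _ _ hP
    · obtain ⟨m, rfl⟩ : ∃ m, n = m + 1 := ⟨n - 1, by omega⟩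
      rw [h, zero_pow (by omega), pow_succ']
      exact hv _ (Bpow hw m)
  · intro hmul w w' hw hw'
    rcases dich w hw with ⟨y, hy, h⟩ | ⟨h, hv⟩
    · rcases dich w' hw' with ⟨y', hy', h'⟩ | ⟨h', hv'⟩
      · have e : w * w' + z * (w * y' + y * (w' + z * y')) = (w + z * y) * (w' + z * y') := by ring
        have hb := Badd hw (Bmul Bz hy)
        have hb' := Badd hw' (Bmul Bz hy')
        rw [Qst w y hw hy h, Qst w' y' hw' hy' h', ← hmul, ← WittVector.mul_coeff_zero, ← e]
        apply Qst _ _ (Bmul hw hw') (Badd (Bmul hw hy') (Bmul hy hb'))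
        rw [e]
        apply le_antisymm _ (P00 (hG1 _ (Bmul hb hb')))
        rw [WittVector.mul_coeff_zero, hmul, ← h, ← h']
        exact hG2 _ _ (Pmul (hG1 _ hb) (hG1 _ hb'))
      · rw [h', mul_zero, mul_comm w]; exact hv' _ hw
    · rw [h, zero_mul]; exact hv _ hw'

end W18

/-- For `z = [z̄₀] + p z₁` a primitive element of `W(S⁺)` (with `z̄₀` topologically
nilpotent and `z₁` a unit of `W(S⁺)`), the quotient seminorm on `W^b(S)/(z)` of the
Gauss norm is power-multiplicative, and multiplicative if the norm on `S` is. -/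
theorem stmt18 (p : ℕ) [Fact p.Prime] {S : Type*} [CommRing S] [CharP S p]
    (nm : S → ℝ) (hnonneg : ∀ s, 0 ≤ nm s) (heq0 : ∀ s, nm s = 0 ↔ s = 0)
    (hna : ∀ s t, nm (s - t) ≤ max (nm s) (nm t))
    (hsm : ∀ s t, nm (s * t) ≤ nm s * nm t)
    (hpm : ∀ (s : S) (n : ℕ), 1 ≤ n → nm (s ^ n) = nm s ^ n)
    (hperf : Function.Bijective fun s : S => s ^ p)
    -- the primitive element z = [z̄₀] + p z₁
    (z z₁ : WittVector p S) (z₀ : S)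
    (hz : z = WittVector.teichmuller p z₀ + p * z₁)
    (hz₀ : Tendsto (fun n : ℕ => nm (z₀ ^ n)) atTop (nhds 0))
    (hz₁ : TeichBddBy p nm 1 z₁ ∧
      ∃ z₁' : WittVector p S, TeichBddBy p nm 1 z₁' ∧ z₁ * z₁' = 1) :
    let tc : WittVector p S → ℕ → S := fun w n =>
      (Function.invFun fun y : S => y ^ p)^[n] (w.coeff n)
    let G : WittVector p S → ℝ := fun w => ⨆ n, nm (tc w n)
    -- the quotient seminorm on W^b(S)/(z)
    let Q : WittVector p S → ℝ := fun w =>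
      sInf {r : ℝ | ∃ y : WittVector p S, (∃ C, TeichBddBy p nm C y) ∧ G (w + z * y) = r}
    (∀ w : WittVector p S, (∃ C, TeichBddBy p nm C w) →
      ∀ n : ℕ, 1 ≤ n → Q (w ^ n) = Q w ^ n) ∧
    ((∀ s t : S, nm (s * t) = nm s * nm t) →
      ∀ w w' : WittVector p S, (∃ C, TeichBddBy p nm C w) →
        (∃ C, TeichBddBy p nm C w') → Q (w * w') = Q w * Q w') := by
  intro tc G Q
  have hp := (Fact.out : p.Prime)
  have hiff : ∀ C w, TeichBddBy p nm C w ↔ W18.PB p nm C w := by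
    intro C w
    constructor
    · intro h
      have hC : 0 ≤ C := by
        obtain ⟨y, -, hy⟩ := h 0
        exact (hnonneg y).trans hy
      refine ⟨hC, fun n => ?_⟩
      obtain ⟨y, hy, hyC⟩ := h n
      rw [← hy, hpm _ _ (Nat.one_le_pow _ _ hp.pos)]
      exact pow_le_pow_left₀ (hnonneg _) hyC _
    · rintro ⟨hC, h⟩ n
      have hb : Function.Surjective fun s : S => s ^ p ^ n := by
        have := hperf.2.iterate n
        rwa [pow_iterate] at this
      obtain ⟨y, hy⟩ := hb (w.coeff n)
      refine ⟨y, hy, ?_⟩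
      have h2 := h n
      rw [← hy, hpm _ _ (Nat.one_le_pow _ _ hp.pos)] at h2
      exact le_of_pow_le_pow_left₀ (pow_pos hp.pos n).ne' hC h2
  have htc : ∀ w n, tc w n ^ p ^ n = w.coeff n := by
    intro w n
    have h := (Function.rightInverse_invFun hperf.2).iterate n (w.coeff n)
    rw [pow_iterate] at h
    exact h
  have hBd : ∀ w, (∃ C, TeichBddBy p nm C w) ↔ W18.Bd p nm w := fun w =>
    exists_congr fun C => hiff C w
  have htcle : ∀ w C, W18.PB p nm C w → ∀ n, nm (tc w n) ≤ C := by
    intro w C h n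
    have h2 := h.2 n
    rw [← htc, hpm _ _ (Nat.one_le_pow _ _ hp.pos)] at h2
    exact le_of_pow_le_pow_left₀ (pow_pos hp.pos n).ne' h.1 h2
  have hz₀' : nm z₀ < 1 := by
    by_contra! hc
    have : (1 : ℝ) ≤ 0 := by
      refine ge_of_tendsto hz₀ ?_
      filter_upwards [eventually_ge_atTop 1] with n hn
      rw [hpm _ _ hn]
      exact one_le_pow₀ hc
    linarith
  obtain ⟨hz₁, z₁', hz₁', hzz⟩ := hz₁
  have := W18.main p nm hnonneg heq0 hna hsm hpm hperf z z₁ z₁' z₀ hz hz₀' ((hiff _ _).1 hz₁)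
    ((hiff _ _).1 hz₁') hzz G Q
    (by
      rintro w ⟨C, hC⟩
      have hbdd : BddAbove (Set.range fun n => nm (tc w n)) :=
        ⟨C, by rintro _ ⟨n, rfl⟩; exact htcle w C hC n⟩
      have hle : ∀ n, nm (tc w n) ≤ G w := fun n => le_ciSup hbdd n
      refine ⟨(hnonneg _).trans (hle 0), fun n => ?_⟩
      rw [← htc, hpm _ _ (Nat.one_le_pow _ _ hp.pos)]
      exact pow_le_pow_left₀ (hnonneg _) (hle n) _)
    (fun w C h => ciSup_le (htcle w C h))
    (by
      intro w
      simp only [Q, hBd])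
  simp only [hBd]
  exact this
end

section
/- Let R₁ → S and R₂ → S be bounded homomorphisms of nonarchimedean Banach rings such that the sum map φ : R₁ ⊕ R₂ → S, (a,b) ↦ image of a plus image of b, is a strict surjection of topological groups. Then there exists a constant c > 0 such that for every positive integer n, every matrix U ∈ GL_n(S) with |U − 1| < c factors as U = φ(U₁) φ(U₂) with U₁ ∈ GL_n(R₁) and U₂ ∈ GL_n(R₂). -/
/-- A (nonarchimedean, commutative) Banach ring norm. -/
structure IsNABanach {B : Type*} [CommRing B] (nm : B → ℝ) : Prop where
  nonneg : ∀ x, 0 ≤ nm x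
  eq_zero_iff : ∀ x, nm x = 0 ↔ x = 0
  nonarch : ∀ x y, nm (x - y) ≤ max (nm x) (nm y)
  submul : ∀ x y, nm (x * y) ≤ nm x * nm y
  complete : ∀ u : ℕ → B,
    (∀ ε : ℝ, 0 < ε → ∃ N, ∀ m ≥ N, ∀ n ≥ N, nm (u m - u n) < ε) →
    ∃ x, ∀ ε : ℝ, 0 < ε → ∃ N, ∀ n ≥ N, nm (u n - x) < ε

open Filter Topology

theorem ultra_sub {M : Type*} [NormedRing M] [IsUltrametricDist M] (x y : M) :
    ‖x - y‖ ≤ max ‖x‖ ‖y‖ := by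
  simpa [sub_eq_add_neg] using IsUltrametricDist.norm_add_le_max x (-y)

theorem core_step {M : Type*} [NormedRing M] [IsUltrametricDist M] {a b : M} {D e : ℝ}
    (hD : 1 ≤ D) (ha : ‖a‖ ≤ D * e) (hb : ‖b‖ ≤ D * e) (he : D ^ 2 * e ≤ 1 / 2) (he0 : 0 ≤ e) :
    ‖(1 - a) * (1 + (a + b)) * (1 - b) - 1‖ ≤ e / 2 := by
  have h0 : D ^ 2 * e ^ 2 ≤ e / 2 := by nlinarith
  have hDe : D * e ≤ 1 := by nlinarith
  have hb1 : ‖b‖ ≤ 1 := hb.trans hDe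
  have hDe0 : 0 ≤ D * e := by positivity
  have key : ∀ x y : M, ‖x‖ ≤ D * e → ‖y‖ ≤ D * e → ‖x * y‖ ≤ e / 2 := by
    intro x y hx hy
    calc ‖x * y‖ ≤ ‖x‖ * ‖y‖ := norm_mul_le _ _
      _ ≤ (D * e) * (D * e) := mul_le_mul hx hy (norm_nonneg _) hDe0
      _ ≤ e / 2 := by nlinarith
  have hz : ‖a * a + a * b‖ ≤ e / 2 :=
    (IsUltrametricDist.norm_add_le_max _ _).trans (max_le (key _ _ ha ha) (key _ _ ha hb))
  have hzb : ‖(a * a + a * b) * b‖ ≤ e / 2 := by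
    calc _ ≤ ‖a * a + a * b‖ * ‖b‖ := norm_mul_le _ _
      _ ≤ ‖a * a + a * b‖ * 1 := by gcongr
      _ ≤ e / 2 := by simpa using hz
  have : (1 - a) * (1 + (a + b)) * (1 - b) - 1
      = ((a * a + a * b) * b - (a * a + a * b)) - b * b := by noncomm_ring
  rw [this]
  refine (ultra_sub _ _).trans (max_le ?_ (key _ _ hb hb))
  exact (ultra_sub _ _).trans (max_le hzb hz)

/-- Convergence of infinite products on the left. -/
theorem core_prod {M : Type*} [NormedRing M] [IsUltrametricDist M] [CompleteSpace M]
    (A P : ℕ → M) (hP0 : P 0 = 1) (D : ℕ → M)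
    (hD : ∀ k, D k = A k * P k ∨ D k = P k * A k)
    (hP : ∀ k, P (k + 1) = P k - D k)
    (hA : ∀ k, ‖A k‖ ≤ 1 / 2 / 2 ^ k) :
    ∃ L : M, IsUnit L ∧ Tendsto P atTop (𝓝 L) := by
  have hA2 : ∀ k, ‖A k‖ ≤ 1 / 2 := fun k => (hA k).trans (div_le_self (by norm_num)
    (one_le_pow₀ (by norm_num)))
  have hDA : ∀ k, ‖P k - 1‖ ≤ 1 / 2 → ‖D k‖ ≤ ‖A k‖ := by
    intro k hk
    have hk1 : ‖P k - 1‖ ≤ 1 := by linarith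
    have h1 : ‖A k * (P k - 1)‖ ≤ ‖A k‖ :=
      (norm_mul_le _ _).trans (mul_le_of_le_one_right (norm_nonneg _) hk1)
    have h2 : ‖(P k - 1) * A k‖ ≤ ‖A k‖ :=
      (norm_mul_le _ _).trans (mul_le_of_le_one_left (norm_nonneg _) hk1)
    rcases hD k with h | h
    · have : D k = A k + A k * (P k - 1) := by rw [h]; noncomm_ring
      rw [this]
      exact (IsUltrametricDist.norm_add_le_max _ _).trans (max_le le_rfl h1)
    · have : D k = A k + (P k - 1) * A k := by rw [h]; noncomm_ring
      rw [this]
      exact (IsUltrametricDist.norm_add_le_max _ _).trans (max_le le_rfl h2)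
  have hinv : ∀ k, ‖P k - 1‖ ≤ 1 / 2 := by
    intro k
    induction k with
    | zero => simp [hP0]
    | succ k ih =>
      have : P (k + 1) - 1 = (P k - 1) - D k := by rw [hP]; abel
      rw [this]
      exact (ultra_sub _ _).trans
        (max_le ih ((hDA k ih).trans (hA2 k)))
  have hc : CauchySeq P := by
    refine cauchySeq_of_le_geometric_two (C := 1) (fun k => ?_)
    rw [dist_eq_norm, hP, sub_sub_cancel]
    exact (hDA k (hinv k)).trans (hA k)
  obtain ⟨L, hL⟩ := cauchySeq_tendsto_of_complete hc
  refine ⟨L, ?_, hL⟩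
  have hL1 : ‖L - 1‖ ≤ 1 / 2 :=
    le_of_tendsto ((hL.sub_const 1).norm) (Eventually.of_forall hinv)
  have hu : IsUnit (1 - (1 - L)) := by
    apply isUnit_one_sub_of_norm_lt_one
    rw [norm_sub_rev]; linarith
  simpa using hu

theorem core_fact {M₁ M₂ M : Type*} [NormedRing M₁] [NormedRing M₂] [NormedRing M]
    [IsUltrametricDist M₁] [IsUltrametricDist M₂] [IsUltrametricDist M]
    [CompleteSpace M₁] [CompleteSpace M₂] (f₁ : M₁ →+* M) (f₂ : M₂ →+* M)
    (C : ℝ) (hC : 1 ≤ C) (hf₁ : ∀ a, ‖f₁ a‖ ≤ C * ‖a‖) (hf₂ : ∀ a, ‖f₂ a‖ ≤ C * ‖a‖)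
    (hs : ∀ s : M, ∃ a b, f₁ a + f₂ b = s ∧ ‖a‖ ≤ C * ‖s‖ ∧ ‖b‖ ≤ C * ‖s‖)
    (U : M) (hU : ‖U - 1‖ < 1 / (2 * C ^ 4)) :
    ∃ U₁ U₂, IsUnit U₁ ∧ IsUnit U₂ ∧ U = f₁ U₁ * f₂ U₂ := by
  choose a b hab ha hb using hs
  set ε : ℝ := 1 / (2 * C ^ 4) with hε
  have hε0 : 0 < ε := by positivity
  have hC4 : C ^ 4 * ε = 1 / 2 := by rw [hε]; field_simp
  have hCε : C * ε ≤ 1 / 2 := by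
    rw [← hC4]; gcongr; exact le_self_pow₀ hC (by norm_num)
  let T : M → M := fun V => (1 - f₁ (a (V - 1))) * V * (1 - f₂ (b (V - 1)))
  let V : ℕ → M := fun k => T^[k] U
  have hVs : ∀ k, V (k + 1) = T (V k) := fun k => Function.iterate_succ_apply' _ _ _
  have hV : ∀ k, ‖V k - 1‖ ≤ ε / 2 ^ k := by
    intro k
    induction k with
    | zero => simpa [V] using hU.le
    | succ k ih =>
      rw [hVs]
      set e := ε / 2 ^ k with he
      have he0 : 0 ≤ e := by positivity
      have heε : e ≤ ε := div_le_self hε0.le (one_le_pow₀ (by norm_num))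
      have h1 : ‖f₁ (a (V k - 1))‖ ≤ C ^ 2 * e := by
        calc _ ≤ C * ‖a (V k - 1)‖ := hf₁ _
          _ ≤ C * (C * ‖V k - 1‖) := by gcongr; exact ha _
          _ ≤ C * (C * e) := by gcongr
          _ = _ := by ring
      have h2 : ‖f₂ (b (V k - 1))‖ ≤ C ^ 2 * e := by
        calc _ ≤ C * ‖b (V k - 1)‖ := hf₂ _
          _ ≤ C * (C * ‖V k - 1‖) := by gcongr; exact hb _
          _ ≤ C * (C * e) := by gcongr
          _ = _ := by ring
      have h3 : (C ^ 2) ^ 2 * e ≤ 1 / 2 := by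
        rw [← hC4, ← pow_mul]; gcongr
      have := core_step (one_le_pow₀ hC) h1 h2 h3 he0
      rw [hab, add_sub_cancel] at this
      rw [pow_succ, ← div_div]
      exact this
  let A : ℕ → M₁ := fun k => a (V k - 1)
  let B : ℕ → M₂ := fun k => b (V k - 1)
  have hbd : ∀ k, C * ‖V k - 1‖ ≤ 1 / 2 / 2 ^ k := by
    intro k
    calc _ ≤ C * (ε / 2 ^ k) := by gcongr; exact hV k
      _ = C * ε / 2 ^ k := by ring
      _ ≤ _ := by gcongr
  let P : ℕ → M₁ := fun k => Nat.rec 1 (fun k p => p - A k * p) k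
  let Q : ℕ → M₂ := fun k => Nat.rec 1 (fun k p => p - p * B k) k
  obtain ⟨p, hp, hPp⟩ := core_prod A P rfl (fun k => A k * P k) (fun k => Or.inl rfl)
    (fun k => rfl) (fun k => (ha _).trans (hbd k))
  obtain ⟨q, hq, hQq⟩ := core_prod B Q rfl (fun k => Q k * B k) (fun k => Or.inr rfl)
    (fun k => rfl) (fun k => (hb _).trans (hbd k))
  have hPQ : ∀ k, V k = f₁ (P k) * U * f₂ (Q k) := by
    intro k
    induction k with
    | zero => simp [V, P, Q]
    | succ k ih =>
      have e1 : P (k + 1) = P k - A k * P k := rfl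
      have e2 : Q (k + 1) = Q k - Q k * B k := rfl
      have e3 : T (V k) = (1 - f₁ (A k)) * V k * (1 - f₂ (B k)) := rfl
      rw [hVs, e1, e2, e3, ih]
      simp only [map_sub, map_mul]
      noncomm_ring
  have c₁ : Continuous f₁ := AddMonoidHomClass.continuous_of_bound f₁ C hf₁
  have c₂ : Continuous f₂ := AddMonoidHomClass.continuous_of_bound f₂ C hf₂
  have l1 : Tendsto V atTop (𝓝 (f₁ p * U * f₂ q)) := by
    rw [funext hPQ]
    exact (((c₁.tendsto _).comp hPp).mul_const U).mul ((c₂.tendsto _).comp hQq)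
  have l2 : Tendsto V atTop (𝓝 1) := by
    rw [tendsto_iff_norm_sub_tendsto_zero]
    refine squeeze_zero (fun _ => norm_nonneg _) hV ?_
    have := (tendsto_pow_atTop_nhds_zero_of_lt_one (r := (1 / 2 : ℝ)) (by norm_num)
      (by norm_num)).const_mul ε
    simpa [div_eq_mul_inv] using this
  have heq : f₁ p * U * f₂ q = 1 := tendsto_nhds_unique l1 l2
  obtain ⟨u, rfl⟩ := hp
  obtain ⟨v, rfl⟩ := hq
  refine ⟨↑u⁻¹, ↑v⁻¹, u⁻¹.isUnit, v⁻¹.isUnit, ?_⟩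
  have i1 : f₁ (↑u⁻¹) * f₁ u = 1 := by rw [← map_mul]; simp
  have i2 : f₂ v * f₂ (↑v⁻¹) = 1 := by rw [← map_mul]; simp
  calc U = (f₁ (↑u⁻¹) * f₁ u) * U * (f₂ v * f₂ (↑v⁻¹)) := by rw [i1, i2]; simp
    _ = f₁ (↑u⁻¹) * (f₁ u * U * f₂ v) * f₂ (↑v⁻¹) := by noncomm_ring
    _ = _ := by rw [heq]; simp

/-- The sup norm makes matrices over an ultrametric ring a normed ring. -/
@[reducible] noncomputable def matNormedRing (n : ℕ) (R : Type*) [NormedCommRing R]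
    [IsUltrametricDist R] : NormedRing (Matrix (Fin n) (Fin n) R) :=
  { (Matrix.normedAddCommGroup : NormedAddCommGroup (Matrix (Fin n) (Fin n) R)),
    (inferInstance : Ring (Matrix (Fin n) (Fin n) R)) with
    norm_mul_le := by
      letI : NormedAddCommGroup (Matrix (Fin n) (Fin n) R) := Matrix.normedAddCommGroup
      intro a b
      change ‖a * b‖ ≤ ‖a‖ * ‖b‖
      rw [Matrix.norm_le_iff (by positivity)]
      intro i j
      rw [Matrix.mul_apply]
      refine IsUltrametricDist.norm_sum_le_of_forall_le_of_nonneg (by positivity) (fun k _ => ?_)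
      exact (norm_mul_le _ _).trans (mul_le_mul (Matrix.norm_entry_le_entrywise_sup_norm a)
        (Matrix.norm_entry_le_entrywise_sup_norm b) (norm_nonneg _) (norm_nonneg _)) }

attribute [local instance] matNormedRing

theorem mat_ultra (n : ℕ) (R : Type*) [NormedCommRing R] [IsUltrametricDist R] :
    IsUltrametricDist (Matrix (Fin n) (Fin n) R) := by
  refine IsUltrametricDist.isUltrametricDist_of_forall_norm_add_le_max_norm (fun a b => ?_)
  refine (Matrix.norm_le_iff (le_max_of_le_left (norm_nonneg a))).2 (fun i j => ?_)
  exact (IsUltrametricDist.norm_add_le_max _ _).trans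
    (max_le_max (Matrix.norm_entry_le_entrywise_sup_norm a)
      (Matrix.norm_entry_le_entrywise_sup_norm b))

theorem mat_complete (n : ℕ) (R : Type*) [NormedCommRing R] [IsUltrametricDist R]
    [CompleteSpace R] : @CompleteSpace (Matrix (Fin n) (Fin n) R)
      (matNormedRing n R).toUniformSpace :=
  inferInstanceAs (CompleteSpace (Fin n → Fin n → R))

theorem mat_fact {R₁ R₂ S : Type*} [NormedCommRing R₁] [NormedCommRing R₂] [NormedCommRing S]
    [IsUltrametricDist R₁] [IsUltrametricDist R₂] [IsUltrametricDist S]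
    [CompleteSpace R₁] [CompleteSpace R₂] (f₁ : R₁ →+* S) (f₂ : R₂ →+* S)
    (C : ℝ) (hC : 1 ≤ C) (hf₁ : ∀ a, ‖f₁ a‖ ≤ C * ‖a‖) (hf₂ : ∀ a, ‖f₂ a‖ ≤ C * ‖a‖)
    (hs : ∀ s : S, ∃ a b, f₁ a + f₂ b = s ∧ ‖a‖ ≤ C * ‖s‖ ∧ ‖b‖ ≤ C * ‖s‖)
    (n : ℕ) (U : Matrix (Fin n) (Fin n) S) (hU : ∀ i j, ‖(U - 1) i j‖ < 1 / (2 * C ^ 4)) :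
    ∃ (U₁ : Matrix (Fin n) (Fin n) R₁) (U₂ : Matrix (Fin n) (Fin n) R₂),
      IsUnit U₁ ∧ IsUnit U₂ ∧ U = U₁.map f₁ * U₂.map f₂ := by
  haveI := mat_ultra n R₁
  haveI := mat_ultra n R₂
  haveI := mat_ultra n S
  haveI := mat_complete n R₁
  haveI := mat_complete n R₂
  have hC0 : 0 ≤ C := by linarith
  refine core_fact (f₁.mapMatrix (m := Fin n)) (f₂.mapMatrix (m := Fin n)) C hC ?_ ?_ ?_ U ?_
  · intro a
    refine (Matrix.norm_le_iff (by positivity)).2 (fun i j => ?_)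
    exact (hf₁ _).trans (mul_le_mul_of_nonneg_left
      (Matrix.norm_entry_le_entrywise_sup_norm a) hC0)
  · intro a
    refine (Matrix.norm_le_iff (by positivity)).2 (fun i j => ?_)
    exact (hf₂ _).trans (mul_le_mul_of_nonneg_left
      (Matrix.norm_entry_le_entrywise_sup_norm a) hC0)
  · intro s
    choose a b hab ha hb using hs
    refine ⟨s.map a, s.map b, ?_, ?_, ?_⟩
    · ext i j
      exact hab _
    · refine (Matrix.norm_le_iff (by positivity)).2 (fun i j => ?_)
      exact (ha _).trans (mul_le_mul_of_nonneg_left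
        (Matrix.norm_entry_le_entrywise_sup_norm s) hC0)
    · refine (Matrix.norm_le_iff (by positivity)).2 (fun i j => ?_)
      exact (hb _).trans (mul_le_mul_of_nonneg_left
        (Matrix.norm_entry_le_entrywise_sup_norm s) hC0)
  · exact (Matrix.norm_lt_iff (by positivity)).2 hU

theorem IsNABanach.neg' {B : Type*} [CommRing B] {nm : B → ℝ} (h : IsNABanach nm) (x : B) :
    nm (-x) = nm x := by
  have h0 : nm 0 = 0 := (h.eq_zero_iff 0).2 rfl
  have key : ∀ y, nm (-y) ≤ nm y := fun y => by
    have := h.nonarch 0 y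
    rwa [zero_sub, h0, max_eq_right (h.nonneg y)] at this
  exact le_antisymm (key x) (by simpa using key (-x))

theorem IsNABanach.add' {B : Type*} [CommRing B] {nm : B → ℝ} (h : IsNABanach nm) (x y : B) :
    nm (x + y) ≤ max (nm x) (nm y) := by
  have := h.nonarch x (-y)
  rwa [sub_neg_eq_add, h.neg'] at this

/-- The normed ring attached to a Banach norm. -/
@[reducible] noncomputable def IsNABanach.normed {B : Type*} [i : CommRing B] {nm : B → ℝ}
    (h : IsNABanach nm) : NormedCommRing B :=
  { AddGroupNorm.toNormedAddCommGroup
      { toFun := nm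
        map_zero' := (h.eq_zero_iff 0).2 rfl
        add_le' := fun x y => (h.add' x y).trans
          (max_le_add_of_nonneg (h.nonneg x) (h.nonneg y))
        neg' := h.neg'
        eq_zero_of_map_eq_zero' := fun x => (h.eq_zero_iff x).1 },
    i with
    norm_mul_le := h.submul }

theorem IsNABanach.ultra {B : Type*} [CommRing B] {nm : B → ℝ}
    (h : IsNABanach nm) : @IsUltrametricDist B h.normed.toDist := by
  letI := h.normed
  exact IsUltrametricDist.isUltrametricDist_of_forall_norm_add_le_max_norm h.add'

theorem IsNABanach.compl {B : Type*} [CommRing B] {nm : B → ℝ}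
    (h : IsNABanach nm) : @CompleteSpace B h.normed.toUniformSpace := by
  letI := h.normed
  refine Metric.complete_of_cauchySeq_tendsto (fun u hu => ?_)
  have hd : ∀ x y : B, dist x y = nm (x - y) := fun x y => dist_eq_norm x y
  obtain ⟨x, hx⟩ := h.complete u (fun ε hε => by
    obtain ⟨N, hN⟩ := Metric.cauchySeq_iff.1 hu ε hε
    exact ⟨N, fun m hm n hn => by rw [← hd]; exact hN m hm n hn⟩)
  refine ⟨x, Metric.tendsto_atTop.2 (fun ε hε => ?_)⟩
  obtain ⟨N, hN⟩ := hx ε hε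
  exact ⟨N, fun n hn => by rw [hd]; exact hN n hn⟩

/-- Matrix factorization over a strict surjection `R₁ ⊕ R₂ → S` of Banach rings:
every invertible matrix over `S` sufficiently close to `1` factors as the product of
an invertible matrix over `R₁` and one over `R₂`. -/
theorem stmt19 {R₁ R₂ S : Type*} [CommRing R₁] [CommRing R₂] [CommRing S]
    (nm₁ : R₁ → ℝ) (nm₂ : R₂ → ℝ) (nmS : S → ℝ)
    (h₁ : IsNABanach nm₁) (h₂ : IsNABanach nm₂) (hS : IsNABanach nmS)
    (r₁ : R₁ →+* S) (r₂ : R₂ →+* S)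
    (hb₁ : ∃ C : ℝ, 0 < C ∧ ∀ a, nmS (r₁ a) ≤ C * nm₁ a)
    (hb₂ : ∃ C : ℝ, 0 < C ∧ ∀ b, nmS (r₂ b) ≤ C * nm₂ b)
    -- strict surjectivity of the sum map (a,b) ↦ r₁ a + r₂ b
    (hstrict : ∃ C : ℝ, 0 < C ∧ ∀ s : S, ∃ (a : R₁) (b : R₂),
      r₁ a + r₂ b = s ∧ nm₁ a ≤ C * nmS s ∧ nm₂ b ≤ C * nmS s) :
    ∃ c : ℝ, 0 < c ∧ ∀ (n : ℕ) (U : Matrix (Fin n) (Fin n) S), IsUnit U →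
      (⨆ i : Fin n, ⨆ j : Fin n, nmS ((U - 1) i j)) < c →
      ∃ (U₁ : Matrix (Fin n) (Fin n) R₁) (U₂ : Matrix (Fin n) (Fin n) R₂),
        IsUnit U₁ ∧ IsUnit U₂ ∧ U = (U₁.map r₁) * (U₂.map r₂) := by
  obtain ⟨C₁, -, hC₁⟩ := hb₁
  obtain ⟨C₂, -, hC₂⟩ := hb₂
  obtain ⟨C₃, -, hC₃⟩ := hstrict
  let C : ℝ := max 1 (max C₁ (max C₂ C₃))
  have k0 : 1 ≤ C := le_max_left _ _
  have k1 : C₁ ≤ C := (le_max_left _ _).trans (le_max_right _ _)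
  have k2 : C₂ ≤ C :=
    (le_max_left _ _).trans ((le_max_right _ _).trans (le_max_right _ _))
  have k3 : C₃ ≤ C :=
    (le_max_right _ _).trans ((le_max_right _ _).trans (le_max_right _ _))
  refine ⟨1 / (2 * C ^ 4), by positivity, fun n U _ hU => ?_⟩
  have hU' : ∀ i j, nmS ((U - 1) i j) < 1 / (2 * C ^ 4) := fun i j =>
    ((le_ciSup (Set.finite_range (fun j => nmS ((U - 1) i j))).bddAbove j).trans
      (le_ciSup (Set.finite_range (fun i => ⨆ j, nmS ((U - 1) i j))).bddAbove i)).trans_lt hU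
  letI := h₁.normed
  letI := h₂.normed
  letI := hS.normed
  haveI := h₁.ultra
  haveI := h₂.ultra
  haveI := hS.ultra
  haveI := h₁.compl
  haveI := h₂.compl
  refine mat_fact r₁ r₂ C k0
    (fun a => (hC₁ a).trans (mul_le_mul_of_nonneg_right k1 (h₁.nonneg a)))
    (fun a => (hC₂ a).trans (mul_le_mul_of_nonneg_right k2 (h₂.nonneg a)))
    (fun s => ?_) n U hU'
  obtain ⟨a, b, e, ha, hb⟩ := hC₃ s
  exact ⟨a, b, e, ha.trans (mul_le_mul_of_nonneg_right k3 (hS.nonneg s)),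
    hb.trans (mul_le_mul_of_nonneg_right k3 (hS.nonneg s))⟩
end
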